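/- arXiv:2005.00933 — 2 statements merged into one kernel-verified Lean document; each statement's English description precedes it below -/
import Mathlib

section
/- Let L and M be sober lattices. Then the cartesian product L × M, equipped with the product topology, is a sober lattice: it is a T0 sober space, its specialization order has least element (0,0), binary joins are computed componentwise, (x,y) ∨ (z,w) = (x ∨ z, y ∨ w), and this join operation is continuous. Moreover, the projections π₁, π₂, the coprojections x ↦ (x,0) and y ↦ (0,y) are homomorphisms of sober lattices, and for any pair of homomorphisms of sober lattices f : L → N and g : M → N the copairing map h : L × M → N, h(x,y) = f(x) ∨ g(y), is a homomorphism of sober lattices. -/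
/-- The specialization order on a topological space: `specLe x y` means every open set
containing `x` contains `y`, i.e. `x ∈ closure {y}`. -/
def specLe {X : Type*} [TopologicalSpace X] (x y : X) : Prop :=
  ∀ U : Set X, IsOpen U → x ∈ U → y ∈ U

/-- The data and axioms making a (T0, sober) topological space into a sober lattice:
a least element and continuous binary joins for the specialization order. -/
structure SoberLatticeStruct (L : Type*) [TopologicalSpace L] where
  bot : L
  join : L → L → L
  bot_le : ∀ x : L, specLe bot x
  le_join_left : ∀ x y : L, specLe x (join x y)
  le_join_right : ∀ x y : L, specLe y (join x y)
  join_le : ∀ x y u : L, specLe x u → specLe y u → specLe (join x y) u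
  continuous_join : Continuous (fun p : L × L => join p.1 p.2)

/-- A homomorphism of sober lattices (with the lattice data given explicitly). -/
def IsSLHom {L M : Type*} [TopologicalSpace L] [TopologicalSpace M]
    (botL : L) (joinL : L → L → L) (botM : M) (joinM : M → M → M) (f : L → M) : Prop :=
  Continuous f ∧ (∀ x y : L, f (joinL x y) = joinM (f x) (f y)) ∧ f botL = botM

/-- The componentwise join on a product. -/
def prodJoin {L M : Type*} [TopologicalSpace L] [TopologicalSpace M]
    (SL : SoberLatticeStruct L) (SM : SoberLatticeStruct M) :
    L × M → L × M → L × M :=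
  fun p q => (SL.join p.1 q.1, SM.join p.2 q.2)

theorem specLe_iff_specializes {X : Type*} [TopologicalSpace X] {x y : X} :
    specLe x y ↔ y ⤳ x :=
  specializes_iff_forall_open.symm

theorem specLe.refl {X : Type*} [TopologicalSpace X] (x : X) : specLe x x :=
  fun _ _ h => h

theorem specLe.trans {X : Type*} [TopologicalSpace X] {x y z : X}
    (hxy : specLe x y) (hyz : specLe y z) : specLe x z :=
  fun U hU hx => hyz U hU (hxy U hU hx)

theorem specLe.antisymm {X : Type*} [TopologicalSpace X] [T0Space X] {x y : X}
    (hxy : specLe x y) (hyx : specLe y x) : x = y :=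
  ((specLe_iff_specializes.1 hyx).antisymm (specLe_iff_specializes.1 hxy)).eq

theorem specLe_prod_iff {X Y : Type*} [TopologicalSpace X] [TopologicalSpace Y] {p q : X × Y} :
    specLe p q ↔ specLe p.1 q.1 ∧ specLe p.2 q.2 := by
  simp only [specLe_iff_specializes]
  exact specializes_prod

/-- The product of two quasi-sober spaces is quasi-sober: the generic points of the closures of
the two projections of an irreducible closed set form its generic point. -/
theorem QuasiSober.prod {X Y : Type*} [TopologicalSpace X] [TopologicalSpace Y]
    [QuasiSober X] [QuasiSober Y] : QuasiSober (X × Y) where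
  sober {S} hS hSc := by
    obtain ⟨a, ha⟩ := QuasiSober.sober
      (hS.image Prod.fst continuous_fst.continuousOn).closure isClosed_closure
    obtain ⟨b, hb⟩ := QuasiSober.sober
      (hS.image Prod.snd continuous_snd.continuousOn).closure isClosed_closure
    have hab : (a, b) ∈ S := by
      rw [← hSc.closure_eq, mem_closure_iff]
      intro W hW hmem
      obtain ⟨U, V, hU, hV, haU, hbV, hUV⟩ := isOpen_prod_iff.1 hW a b hmem
      obtain ⟨_, hxU, p, hpS, rfl⟩ := mem_closure_iff.1 ha.mem U hU haU
      obtain ⟨_, hyV, q, hqS, rfl⟩ := mem_closure_iff.1 hb.mem V hV hbV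
      obtain ⟨r, hrS, hrU, hrV⟩ := hS.isPreirreducible _ _ (hU.preimage continuous_fst)
        (hV.preimage continuous_snd) ⟨p, hpS, hxU⟩ ⟨q, hqS, hyV⟩
      exact ⟨r, hUV ⟨hrU, hrV⟩, hrS⟩
    refine ⟨(a, b), isGenericPoint_iff_specializes.2 fun p =>
      ⟨fun h => h.mem_closed hSc hab, fun hp => ?_⟩⟩
    exact (ha.specializes (subset_closure (Set.mem_image_of_mem _ hp))).prod
      (hb.specializes (subset_closure (Set.mem_image_of_mem _ hp)))

namespace SoberLatticeStruct

variable {L : Type*} [TopologicalSpace L] (SL : SoberLatticeStruct L)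

theorem join_mono {x x' y y' : L} (hx : specLe x x') (hy : specLe y y') :
    specLe (SL.join x y) (SL.join x' y') :=
  SL.join_le _ _ _ (hx.trans (SL.le_join_left _ _)) (hy.trans (SL.le_join_right _ _))

theorem join_self [T0Space L] (x : L) : SL.join x x = x :=
  (SL.join_le _ _ _ (.refl x) (.refl x)).antisymm (SL.le_join_left _ _)

theorem specLe_join_join_join_comm (x y z w : L) :
    specLe (SL.join (SL.join x y) (SL.join z w)) (SL.join (SL.join x z) (SL.join y w)) :=
  SL.join_le _ _ _ (SL.join_mono (SL.le_join_left _ _) (SL.le_join_left _ _))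
    (SL.join_mono (SL.le_join_right _ _) (SL.le_join_right _ _))

theorem join_join_join_comm [T0Space L] (x y z w : L) :
    SL.join (SL.join x y) (SL.join z w) = SL.join (SL.join x z) (SL.join y w) :=
  (SL.specLe_join_join_join_comm x y z w).antisymm (SL.specLe_join_join_join_comm x z y w)

end SoberLatticeStruct

theorem stmt1 {L M N : Type*} [TopologicalSpace L] [TopologicalSpace M] [TopologicalSpace N]
    [T0Space L] [T0Space M] [T0Space N] [QuasiSober L] [QuasiSober M] [QuasiSober N]
    (SL : SoberLatticeStruct L) (SM : SoberLatticeStruct M) (SN : SoberLatticeStruct N) :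
    -- the product is a T0 sober space
    T0Space (L × M) ∧ QuasiSober (L × M) ∧
    -- (bot L, bot M) is the least element of the specialization order of the product
    (∀ p : L × M, specLe (SL.bot, SM.bot) p) ∧
    -- componentwise joins are joins in the specialization order of the product
    (∀ p q : L × M, specLe p (prodJoin SL SM p q) ∧ specLe q (prodJoin SL SM p q) ∧
      ∀ u : L × M, specLe p u → specLe q u → specLe (prodJoin SL SM p q) u) ∧
    -- the join operation is continuous
    Continuous (fun x : (L × M) × (L × M) => prodJoin SL SM x.1 x.2) ∧
    -- the projections are homomorphisms of sober lattices
    IsSLHom (SL.bot, SM.bot) (prodJoin SL SM) SL.bot SL.join (Prod.fst) ∧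
    IsSLHom (SL.bot, SM.bot) (prodJoin SL SM) SM.bot SM.join (Prod.snd) ∧
    -- the coprojections are homomorphisms of sober lattices
    IsSLHom SL.bot SL.join (SL.bot, SM.bot) (prodJoin SL SM) (fun x => (x, SM.bot)) ∧
    IsSLHom SM.bot SM.join (SL.bot, SM.bot) (prodJoin SL SM) (fun y => (SL.bot, y)) ∧
    -- the copairing of two homomorphisms is a homomorphism
    (∀ (f : L → N) (g : M → N),
      IsSLHom SL.bot SL.join SN.bot SN.join f →
      IsSLHom SM.bot SM.join SN.bot SN.join g →
      IsSLHom (SL.bot, SM.bot) (prodJoin SL SM) SN.bot SN.join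
        (fun p : L × M => SN.join (f p.1) (g p.2))) := by
  refine ⟨inferInstance, QuasiSober.prod,
    fun p => specLe_prod_iff.2 ⟨SL.bot_le p.1, SM.bot_le p.2⟩,
    fun p q => ⟨specLe_prod_iff.2 ⟨SL.le_join_left _ _, SM.le_join_left _ _⟩,
      specLe_prod_iff.2 ⟨SL.le_join_right _ _, SM.le_join_right _ _⟩, fun u hp hq => ?_⟩,
    ?_, ⟨continuous_fst, fun _ _ => rfl, rfl⟩, ⟨continuous_snd, fun _ _ => rfl, rfl⟩,
    ⟨by fun_prop, fun _ _ => Prod.ext rfl (SM.join_self _).symm, rfl⟩,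
    ⟨by fun_prop, fun _ _ => Prod.ext (SL.join_self _).symm rfl, rfl⟩, ?_⟩
  · rw [specLe_prod_iff] at hp hq ⊢
    exact ⟨SL.join_le _ _ _ hp.1 hq.1, SM.join_le _ _ _ hp.2 hq.2⟩
  · exact (SL.continuous_join.comp (by fun_prop :
        Continuous fun x : (L × M) × (L × M) => (x.1.1, x.2.1))).prodMk
      (SM.continuous_join.comp (by fun_prop :
        Continuous fun x : (L × M) × (L × M) => (x.1.2, x.2.2)))
  · rintro f g ⟨hf, hfj, hf0⟩ ⟨hg, hgj, hg0⟩
    refine ⟨SN.continuous_join.comp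
      ((hf.comp continuous_fst).prodMk (hg.comp continuous_snd)), fun p q => ?_, ?_⟩
    · simp only [prodJoin, hfj, hgj]
      exact SN.join_join_join_comm _ _ _ _
    · simp only [hf0, hg0, SN.join_self]
end

section
/- Let A be a C*-algebra. Then A is commutative if and only if Max A is commutative, i.e. if and only if for all closed linear subspaces P, Q of A one has PQ = QP, where PQ denotes the closure of the linear span of the pointwise product {ab : a ∈ P, b ∈ Q}. -/
open Pointwise

/-- `MaxA A` is the set of closed linear subspaces of `A`. -/
def MaxA (A : Type*) [AddCommGroup A] [Module ℂ A] [TopologicalSpace A] :=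
  {P : Submodule ℂ A // IsClosed (P : Set A)}

/-- The multiplication on `MaxA A` for a C*-algebra `A`: `PQ` is the closure of the
linear span of the set of pointwise products `{a * b : a ∈ P, b ∈ Q}`. -/
noncomputable def maxMul {A : Type*} [NonUnitalCStarAlgebra A] (P Q : MaxA A) : MaxA A :=
  ⟨(Submodule.span ℂ
      (((P.1 : Submodule ℂ A) : Set A) * ((Q.1 : Submodule ℂ A) : Set A))).topologicalClosure,
    Submodule.isClosed_topologicalClosure _⟩

section

variable {A : Type*} [NonUnitalCStarAlgebra A]

/-- The line spanned by an element, as a closed linear subspace. -/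
noncomputable def MaxA.line (a : A) : MaxA A :=
  ⟨Submodule.span ℂ {a}, Submodule.closed_of_finiteDimensional _⟩

theorem maxMul_line_line (a b : A) : maxMul (MaxA.line a) (MaxA.line b) = MaxA.line (a * b) := by
  apply Subtype.ext
  have h : Submodule.span ℂ (((Submodule.span ℂ {a} : Submodule ℂ A) : Set A) *
      ((Submodule.span ℂ {b} : Submodule ℂ A) : Set A)) = Submodule.span ℂ {a * b} := by
    apply le_antisymm
    · rw [Submodule.span_le]
      rintro _ ⟨x, hx, y, hy, rfl⟩
      obtain ⟨s, rfl⟩ := Submodule.mem_span_singleton.1 hx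
      obtain ⟨t, rfl⟩ := Submodule.mem_span_singleton.1 hy
      refine Submodule.mem_span_singleton.2 ⟨t * s, ?_⟩
      simp only [smul_mul_assoc, mul_smul_comm, smul_smul]
    · rw [Submodule.span_le, Set.singleton_subset_iff]
      exact Submodule.subset_span (Set.mul_mem_mul (Submodule.mem_span_singleton_self a)
        (Submodule.mem_span_singleton_self b))
  change (Submodule.span ℂ (_ * _)).topologicalClosure = Submodule.span ℂ {a * b}
  exact (congrArg Submodule.topologicalClosure h).trans
    (MaxA.line (a * b)).2.submodule_topologicalClosure_eq

theorem exists_smul_mul_eq_of_maxMul_comm (h : ∀ P Q : MaxA A, maxMul P Q = maxMul Q P)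
    (a b : A) : ∃ c : ℂ, c • (b * a) = a * b := by
  have hab := h (MaxA.line a) (MaxA.line b)
  rw [maxMul_line_line, maxMul_line_line] at hab
  have hspan : Submodule.span ℂ {a * b} = Submodule.span ℂ {b * a} := congrArg Subtype.val hab
  exact Submodule.mem_span_singleton.1 (hspan ▸ Submodule.mem_span_singleton_self (a * b))

theorem IsSelfAdjoint.eq_zero_of_mul_self_eq_zero {a : A} (ha : IsSelfAdjoint a)
    (h : a * a = 0) : a = 0 := by
  rw [← CStarRing.star_mul_self_eq_zero_iff, ha.star_eq, h]

/-- If `a` is self-adjoint and `a * b` is always a multiple of `b * a`, then `a` is central: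
otherwise comparing the multiples for `b` and `b + a` makes `b * a` a multiple of `a * a`. -/
theorem IsSelfAdjoint.mul_comm_of_exists_smul {a : A} (ha : IsSelfAdjoint a)
    (h : ∀ b : A, ∃ c : ℂ, c • (b * a) = a * b) (b : A) : a * b = b * a := by
  obtain ⟨l, hl⟩ := h b
  obtain ⟨m, hm⟩ := h (b + a)
  rw [add_mul, mul_add, smul_add, ← hl] at hm
  have key : (l - m) • (b * a) = (m - 1) • (a * a) := by
    linear_combination (norm := module) -hm
  by_cases hlm : l - m = 0
  · rw [hlm, zero_smul] at key
    rcases smul_eq_zero.1 key.symm with h1 | h1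
    · have : l = 1 := by linear_combination hlm + h1
      rw [← hl, this, one_smul]
    · simp [ha.eq_zero_of_mul_self_eq_zero h1]
  · obtain ⟨d, hd⟩ : ∃ d : ℂ, b * a = d • (a * a) :=
      ⟨(l - m)⁻¹ * (m - 1), by rw [mul_smul, ← key, inv_smul_smul₀ hlm]⟩
    have hcube : (l * d - d) • (a * a * a) = 0 := by
      have hassoc := mul_assoc a b a
      rw [← hl, hd, smul_smul, smul_mul_assoc, mul_smul_comm, ← mul_assoc] at hassoc
      rw [sub_smul, hassoc, sub_self]
    rcases smul_eq_zero.1 hcube with h1 | h1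
    · rw [← hl, hd, smul_smul, sub_eq_zero.1 h1]
    · have hsq : IsSelfAdjoint (a * a) := by simpa [ha.star_eq] using IsSelfAdjoint.star_mul_self a
      have h2 : a * a = 0 := hsq.eq_zero_of_mul_self_eq_zero (by rw [← mul_assoc, h1, zero_mul])
      simp [ha.eq_zero_of_mul_self_eq_zero h2]

end

theorem stmt17 (A : Type*) [NonUnitalCStarAlgebra A] :
    (∀ a b : A, a * b = b * a) ↔ (∀ P Q : MaxA A, maxMul P Q = maxMul Q P) := by
  constructor
  · intro h P Q
    apply Subtype.ext
    have hset : (P.1 : Set A) * (Q.1 : Set A) = (Q.1 : Set A) * (P.1 : Set A) :=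
      Set.image2_comm h
    exact congrArg (fun s => (Submodule.span ℂ s).topologicalClosure) hset
  · intro h a b
    have hsa : ∀ x : selfAdjoint A, (x : A) * b = b * x := fun x =>
      x.2.mul_comm_of_exists_smul (exists_smul_mul_eq_of_maxMul_comm h _) b
    rw [← realPart_add_I_smul_imaginaryPart a, add_mul, mul_add, smul_mul_assoc, mul_smul_comm,
      hsa, hsa]
end
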